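/- Let d ≥ 1 and α ∈ (0,2). The vector field B is continuously differentiable and for all x ∈ ℝ^d its divergence satisfies div B(x) = Δ^{α/2} ρ_α(x), i.e., ∑_{i=1}^d ∂_i B_i(x) = (α 2^α Γ((d+α)/2) / (Γ(d/2) Γ((2−α)/2))) ∫_{ℝ^d} (ρ_α(x+z) + ρ_α(x−z) − 2 ρ_α(x)) |z|^{−d−α} dz. -/

import Mathlib

open MeasureTheory Real

noncomputable section

/-- `ρ_α(x) = (1+|x|²)^{-(d+α)/2}`. -/
def rhoA (d : ℕ) (α : ℝ) (x : EuclideanSpace ℝ (Fin d)) : ℝ :=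
  (1 + ‖x‖ ^ 2) ^ (-(((d : ℝ) + α) / 2))

/-- `c_{d,α} = 2^α Γ((d+α)/2) / (Γ(d/2) Γ((2-α)/2))`. -/
def cdA (d : ℕ) (α : ℝ) : ℝ :=
  2 ^ α * Real.Gamma (((d : ℝ) + α) / 2)
    / (Real.Gamma ((d : ℝ) / 2) * Real.Gamma ((2 - α) / 2))

/-- `B(x) = c_{d,α} ∫ y (ρ_α(x+y) - ρ_α(x-y)) |y|^{-d-α} dy`. -/
def fieldB (d : ℕ) (α : ℝ) (x : EuclideanSpace ℝ (Fin d)) : EuclideanSpace ℝ (Fin d) :=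
  cdA d α • ∫ y : EuclideanSpace ℝ (Fin d),
    ((rhoA d α (x + y) - rhoA d α (x - y)) * ‖y‖ ^ (-(d : ℝ) - α)) • y

/-- The derivative of `rhoA`. -/
def rhoD (d : ℕ) (α : ℝ) (x : EuclideanSpace ℝ (Fin d)) : EuclideanSpace ℝ (Fin d) →L[ℝ] ℝ :=
  (-((d : ℝ) + α) * (1 + ‖x‖ ^ 2) ^ (-(((d : ℝ) + α) / 2) - 1)) • innerSL ℝ x

/-- The dominating function. -/
def domH (d : ℕ) (α : ℝ) (y : EuclideanSpace ℝ (Fin d)) : ℝ :=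
  (Metric.ball (0 : EuclideanSpace ℝ (Fin d)) 1).indicator
    (fun y => ‖y‖ ^ (2 - (d : ℝ) - α)) y + rhoA d α y

lemma one_le_w {d : ℕ} (x : EuclideanSpace ℝ (Fin d)) : 1 ≤ 1 + ‖x‖ ^ 2 := by
  nlinarith [sq_nonneg ‖x‖]

lemma rhoA_pos (d : ℕ) (α : ℝ) (x : EuclideanSpace ℝ (Fin d)) : 0 < rhoA d α x := by
  have := one_le_w x
  exact rpow_pos_of_pos (by linarith) _

lemma rhoA_le_one (d : ℕ) (α : ℝ) (hα : 0 < α) (x : EuclideanSpace ℝ (Fin d)) :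
    rhoA d α x ≤ 1 := by
  apply rpow_le_one_of_one_le_of_nonpos (one_le_w x)
  have : (0 : ℝ) ≤ d := Nat.cast_nonneg d
  linarith

/-- Comparison of values of `rhoA`. -/
lemma rhoA_le_mul (d : ℕ) (α : ℝ) (hα : 0 < α) (x y : EuclideanSpace ℝ (Fin d)) {c : ℝ}
    (hc : 0 < c) (h : 1 + ‖y‖ ^ 2 ≤ c * (1 + ‖x‖ ^ 2)) :
    rhoA d α x ≤ c ^ (((d : ℝ) + α) / 2) * rhoA d α y := by
  have hx := one_le_w x
  have hy := one_le_w y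
  have hdα : 0 ≤ ((d : ℝ) + α) / 2 := by positivity
  have h1 : (1 + ‖y‖ ^ 2) ^ (((d : ℝ) + α) / 2)
      ≤ c ^ (((d : ℝ) + α) / 2) * (1 + ‖x‖ ^ 2) ^ (((d : ℝ) + α) / 2) := by
    rw [← mul_rpow hc.le (by linarith)]
    exact rpow_le_rpow (by linarith) h hdα
  unfold rhoA
  rw [rpow_neg (by linarith), rpow_neg (by linarith)]
  have p1 : 0 < (1 + ‖x‖ ^ 2) ^ (((d : ℝ) + α) / 2) := rpow_pos_of_pos (by linarith) _
  have p2 : 0 < (1 + ‖y‖ ^ 2) ^ (((d : ℝ) + α) / 2) := rpow_pos_of_pos (by linarith) _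
  rw [← div_eq_mul_inv, le_div_iff₀ p2, inv_mul_le_iff₀ p1]
  linarith

/-- Peetre type inequality. -/
lemma rhoA_add_le (d : ℕ) (α : ℝ) (hα : 0 < α) (x y : EuclideanSpace ℝ (Fin d)) {R : ℝ}
    (hx : ‖x‖ ≤ R) :
    rhoA d α (x + y) ≤ (2 * (1 + R ^ 2)) ^ (((d : ℝ) + α) / 2) * rhoA d α y := by
  apply rhoA_le_mul d α hα _ _ (by positivity)
  have h1 : ‖y‖ ≤ ‖x + y‖ + ‖x‖ := by
    have := norm_sub_le (x + y) x
    simpa using this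
  have h0 := norm_nonneg x
  have h2 : ‖x‖ ^ 2 ≤ R ^ 2 := by gcongr
  have h3 : ‖y‖ ^ 2 ≤ (‖x + y‖ + ‖x‖) ^ 2 := by gcongr
  nlinarith [sq_nonneg (‖x + y‖ - ‖x‖), mul_nonneg (sq_nonneg R) (sq_nonneg ‖x + y‖)]

lemma rhoA_neg (d : ℕ) (α : ℝ) (x : EuclideanSpace ℝ (Fin d)) : rhoA d α (-x) = rhoA d α x := by
  simp [rhoA]

lemma rhoA_sub_le (d : ℕ) (α : ℝ) (hα : 0 < α) (x y : EuclideanSpace ℝ (Fin d)) {R : ℝ}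
    (hx : ‖x‖ ≤ R) :
    rhoA d α (x - y) ≤ (2 * (1 + R ^ 2)) ^ (((d : ℝ) + α) / 2) * rhoA d α y := by
  have := rhoA_add_le d α hα x (-y) hx
  rwa [rhoA_neg, ← sub_eq_add_neg] at this

lemma hasFDerivAt_w {d : ℕ} (x : EuclideanSpace ℝ (Fin d)) :
    HasFDerivAt (fun x : EuclideanSpace ℝ (Fin d) => 1 + ‖x‖ ^ 2) (2 • (innerSL ℝ) x) x :=
  (hasStrictFDerivAt_norm_sq x).hasFDerivAt.const_add 1

lemma hasFDerivAt_rhoA (d : ℕ) (α : ℝ) (x : EuclideanSpace ℝ (Fin d)) :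
    HasFDerivAt (rhoA d α) (rhoD d α x) x := by
  have hx := one_le_w x
  have h := (hasFDerivAt_w x).rpow_const (p := -(((d : ℝ) + α) / 2)) (Or.inl (by linarith))
  have e : rhoD d α x = (-(((d : ℝ) + α) / 2) * (1 + ‖x‖ ^ 2) ^ (-(((d : ℝ) + α) / 2) - 1)) •
      2 • (innerSL ℝ) x := by
    ext v
    simp [rhoD]
    ring
  rw [e]
  exact h

lemma continuous_rhoA (d : ℕ) (α : ℝ) : Continuous (rhoA d α) :=
  continuous_iff_continuousAt.2 fun x => (hasFDerivAt_rhoA d α x).continuousAt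

lemma norm_rhoD_le (d : ℕ) (α : ℝ) (hα : 0 < α) (x : EuclideanSpace ℝ (Fin d)) :
    ‖rhoD d α x‖ ≤ (d + α) * rhoA d α x := by
  have hx := one_le_w x
  have h1 : ‖x‖ ≤ 1 + ‖x‖ ^ 2 := by nlinarith [sq_nonneg (‖x‖ - 1), norm_nonneg x]
  have hd : (0 : ℝ) ≤ d := Nat.cast_nonneg d
  have hw : 0 < 1 + ‖x‖ ^ 2 := by linarith
  rw [rhoD, norm_smul, innerSL_apply_norm, norm_mul, norm_neg, Real.norm_of_nonneg (by linarith),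
    Real.norm_of_nonneg (rpow_nonneg hw.le _), rpow_sub_one hw.ne', mul_assoc]
  change _ ≤ (d + α) * (1 + ‖x‖ ^ 2) ^ (-(((d : ℝ) + α) / 2))
  gcongr
  rw [div_mul_eq_mul_div, div_le_iff₀ hw]
  gcongr

/-- Lipschitz constant of `rhoD`. -/
def lipC (d : ℕ) (α : ℝ) : ℝ := (d + α) * (d + α + 3)

lemma rhoD_lip (d : ℕ) (α : ℝ) (hα : 0 < α) :
    (∀ x, DifferentiableAt ℝ (rhoD d α) x) ∧
    ∀ x y, ‖rhoD d α y - rhoD d α x‖ ≤ lipC d α * ‖y - x‖ := by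
  have hd : (0 : ℝ) ≤ d := Nat.cast_nonneg d
  obtain ⟨I, hI⟩ : ∃ I : EuclideanSpace ℝ (Fin d) →L[ℝ] EuclideanSpace ℝ (Fin d) →L[ℝ] ℝ,
      ∀ x, I x = innerSL ℝ x := ⟨innerSL ℝ, fun _ => rfl⟩
  have hrw : rhoD d α = fun x =>
      (-((d : ℝ) + α) * (1 + ‖x‖ ^ 2) ^ (-(((d : ℝ) + α) / 2) - 1)) • I x := by
    funext x
    rw [hI, rhoD]
  have key : ∀ x : EuclideanSpace ℝ (Fin d), ∃ T : EuclideanSpace ℝ (Fin d) →L[ℝ] EuclideanSpace ℝ (Fin d) →L[ℝ] ℝ, HasFDerivAt (rhoD d α) T x ∧ ‖T‖ ≤ lipC d α := by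
    intro x
    have hx := one_le_w x
    have hw : 0 < 1 + ‖x‖ ^ 2 := by linarith
    have h := ((hasFDerivAt_w x).rpow_const (p := -(((d : ℝ) + α) / 2) - 1)
      (Or.inl (by linarith))).const_mul (-((d : ℝ) + α))
    have h2 := h.fun_smul I.hasFDerivAt (x := x)
    rw [hrw]
    refine ⟨_, h2, ?_⟩
    have hp : (1 + ‖x‖ ^ 2) ^ (-(((d : ℝ) + α) / 2) - 1) ≤ 1 :=
      rpow_le_one_of_one_le_of_nonpos hx (by linarith)
    have hp0 : 0 ≤ (1 + ‖x‖ ^ 2) ^ (-(((d : ℝ) + α) / 2) - 1) := rpow_nonneg hw.le _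
    refine le_trans (ContinuousLinearMap.opNorm_add_le _ _) ?_
    have e1 : ‖(-((d : ℝ) + α) * (1 + ‖x‖ ^ 2) ^ (-(((d : ℝ) + α) / 2) - 1)) •
        I‖ ≤ (d + α) * 1 * 1 := by
      refine ContinuousLinearMap.opNorm_le_bound _ (by positivity) fun v => ?_
      rw [smul_apply, hI, norm_smul, innerSL_apply_norm, norm_mul, norm_neg,
        Real.norm_of_nonneg (by linarith : 0 ≤ (d : ℝ) + α), Real.norm_of_nonneg hp0, mul_one]
      gcongr
    have e2 : ‖(-((d : ℝ) + α)) • ((-(((d : ℝ) + α) / 2) - 1) *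
        (1 + ‖x‖ ^ 2) ^ (-(((d : ℝ) + α) / 2) - 1 - 1)) • (2 • innerSL ℝ x)‖ * ‖x‖
        ≤ (d + α) * (d + α + 2) := by
      rw [norm_smul, norm_smul, norm_neg, Real.norm_of_nonneg (by linarith : 0 ≤ (d : ℝ) + α),
        norm_mul, Real.norm_of_nonneg (rpow_nonneg hw.le _), ← Nat.cast_smul_eq_nsmul ℝ, norm_smul,
        innerSL_apply_norm, rpow_sub_one hw.ne', Real.norm_of_nonpos (by linarith)]
      have : (1 + ‖x‖ ^ 2) ^ (-(((d : ℝ) + α) / 2) - 1) / (1 + ‖x‖ ^ 2) * ‖x‖ ^ 2 ≤ 1 := by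
        rw [div_mul_eq_mul_div, div_le_iff₀ hw]
        nlinarith [sq_nonneg ‖x‖]
      norm_num
      have h3 := mul_le_mul_of_nonneg_left this
        (by positivity : 0 ≤ ((d : ℝ) + α) * (d + α + 2))
      nlinarith [h3]
    rw [ContinuousLinearMap.norm_smulRight_apply, hI, innerSL_apply_norm]
    unfold lipC
    linarith
  refine ⟨fun x => (key x).choose_spec.1.differentiableAt, fun x y => ?_⟩
  choose T hT hT' using key
  exact Convex.norm_image_sub_le_of_norm_hasFDerivWithin_le (s := Set.univ)
    (fun x _ => (hT x).hasFDerivWithinAt) (fun x _ => hT' x) convex_univ trivial trivial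

lemma continuous_rhoD (d : ℕ) (α : ℝ) (hα : 0 < α) : Continuous (rhoD d α) :=
  continuous_iff_continuousAt.2 fun x => ((rhoD_lip d α hα).1 x).continuousAt

lemma rhoA_lip (d : ℕ) (α : ℝ) (hα : 0 < α) (x y : EuclideanSpace ℝ (Fin d)) :
    ‖rhoA d α y - rhoA d α x‖ ≤ (d + α) * ‖y - x‖ := by
  refine Convex.norm_image_sub_le_of_norm_hasFDerivWithin_le (s := Set.univ)
    (fun x _ => (hasFDerivAt_rhoA d α x).hasFDerivWithinAt) (fun x _ => ?_) convex_univ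
    trivial trivial
  refine (norm_rhoD_le d α hα x).trans ?_
  have := rhoA_le_one d α hα x
  have hd : (0 : ℝ) ≤ d := Nat.cast_nonneg d
  nlinarith

lemma domH_nonneg (d : ℕ) (α : ℝ) (y : EuclideanSpace ℝ (Fin d)) : 0 ≤ domH d α y := by
  unfold domH
  have := rhoA_pos d α y
  have : 0 ≤ (Metric.ball (0 : EuclideanSpace ℝ (Fin d)) 1).indicator
    (fun y => ‖y‖ ^ (2 - (d : ℝ) - α)) y :=
    Set.indicator_nonneg (fun y _ => rpow_nonneg (norm_nonneg y) _) _
  linarith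

lemma domH_integrable (d : ℕ) (hd : 1 ≤ d) (α : ℝ) (hα : α ∈ Set.Ioo (0 : ℝ) 2) :
    Integrable (domH d α) := by
  refine Integrable.add ?_ ?_
  · rw [integrable_indicator_iff Metric.isOpen_ball.measurableSet]
    apply integrableOn_ball_of_norm_le_rpow (by simpa using hd) (C := 1) (α := d + α - 2)
    · simp
      linarith [hα.2]
    · refine Filter.Eventually.of_forall fun y => ?_
      rw [Real.norm_of_nonneg (rpow_nonneg (norm_nonneg y) _), one_mul]
      apply le_of_eq
      congr 1
      ring
    · exact (measurable_norm.pow_const _).aestronglyMeasurable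
  · have h := integrable_rpow_neg_one_add_norm_sq (E := EuclideanSpace ℝ (Fin d)) (μ := volume)
      (r := d + α) (by simp; exact hα.1)
    have e : rhoA d α = fun y => (1 + ‖y‖ ^ 2) ^ (-((d : ℝ) + α) / 2) := by
      funext y
      unfold rhoA
      congr 1
      ring
    rw [e]
    exact h

lemma domH_bound (d : ℕ) (hd : 1 ≤ d) (α : ℝ) (hα : 0 < α) {a A : ℝ} (ha : 0 ≤ a)
    (y : EuclideanSpace ℝ (Fin d))
    (h1 : a ≤ A * ‖y‖) (h2 : a ≤ A * rhoA d α y) :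
    a * (‖y‖ ^ (-(d : ℝ) - α) * ‖y‖) ≤ A * domH d α y := by
  have hr := rhoA_pos d α y
  have hA : 0 ≤ A := by
    by_contra h
    nlinarith
  have hdd : (1 : ℝ) ≤ d := by exact_mod_cast hd
  rcases eq_or_ne y 0 with rfl | hy
  · simp only [norm_zero, mul_zero]
    exact mul_nonneg hA (domH_nonneg _ _ _)
  have hy0 : 0 < ‖y‖ := norm_pos_iff.2 hy
  by_cases hb : ‖y‖ < 1
  · have e : domH d α y = ‖y‖ ^ (2 - (d : ℝ) - α) + rhoA d α y := by
      unfold domH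
      rw [Set.indicator_of_mem (by simpa using hb)]
    have e2 : ‖y‖ ^ (2 - (d : ℝ) - α) = ‖y‖ * (‖y‖ ^ (-(d : ℝ) - α) * ‖y‖) := by
      rw [show 2 - (d : ℝ) - α = (-(d : ℝ) - α) + 1 + 1 by ring, rpow_add_one hy0.ne',
        rpow_add_one hy0.ne']
      ring
    have h3 : a * (‖y‖ ^ (-(d : ℝ) - α) * ‖y‖) ≤ A * ‖y‖ * (‖y‖ ^ (-(d : ℝ) - α) * ‖y‖) := by
      gcongr
    rw [e, e2]
    nlinarith [mul_nonneg hA hr.le]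
  · have e : domH d α y = rhoA d α y := by
      unfold domH
      rw [Set.indicator_of_notMem (by simpa using hb), zero_add]
    rw [e, ← rpow_add_one hy0.ne']
    have : ‖y‖ ^ (-(d : ℝ) - α + 1) ≤ 1 :=
      rpow_le_one_of_one_le_of_nonpos (not_lt.1 hb) (by linarith)
    calc _ ≤ a * 1 := by gcongr
      _ ≤ _ := by linarith

lemma domH_bound2 (d : ℕ) (α : ℝ) (hα : 0 < α) {a A : ℝ} (ha : 0 ≤ a) (hA : 0 ≤ A)
    (y : EuclideanSpace ℝ (Fin d))
    (h1 : a ≤ A * ‖y‖ ^ 2) (h2 : a ≤ A) :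
    a * ‖y‖ ^ (-(d : ℝ) - α) ≤ (A * 2 ^ (((d : ℝ) + α) / 2)) * domH d α y := by
  have hr := rhoA_pos d α y
  have hdd : (0 : ℝ) ≤ d := Nat.cast_nonneg d
  have h2p : (1 : ℝ) ≤ 2 ^ (((d : ℝ) + α) / 2) := one_le_rpow (by norm_num) (by positivity)
  have hH := domH_nonneg d α y
  rcases eq_or_ne y 0 with rfl | hy
  · have : a = 0 := by simp at h1; linarith
    rw [this, zero_mul]
    positivity
  have hy0 : 0 < ‖y‖ := norm_pos_iff.2 hy
  by_cases hb : ‖y‖ < 1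
  · have e : domH d α y = ‖y‖ ^ (2 - (d : ℝ) - α) + rhoA d α y := by
      unfold domH
      rw [Set.indicator_of_mem (by simpa using hb)]
    have e2 : ‖y‖ ^ (2 - (d : ℝ) - α) = ‖y‖ ^ 2 * ‖y‖ ^ (-(d : ℝ) - α) := by
      rw [show 2 - (d : ℝ) - α = (-(d : ℝ) - α) + 1 + 1 by ring, rpow_add_one hy0.ne',
        rpow_add_one hy0.ne']
      ring
    have h3 : a * ‖y‖ ^ (-(d : ℝ) - α) ≤ A * ‖y‖ ^ 2 * ‖y‖ ^ (-(d : ℝ) - α) := by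
      gcongr
    calc _ ≤ A * domH d α y := by rw [e, e2]; nlinarith [mul_nonneg hA hr.le]
      _ ≤ _ := by
        gcongr
        nlinarith
  · have e : domH d α y = rhoA d α y := by
      unfold domH
      rw [Set.indicator_of_notMem (by simpa using hb), zero_add]
    have hy1 := not_lt.1 hb
    have h3 : ‖y‖ ^ (-(d : ℝ) - α) ≤ 2 ^ (((d : ℝ) + α) / 2) * rhoA d α y := by
      have e3 : ‖y‖ ^ (-(d : ℝ) - α) = (‖y‖ ^ 2) ^ (-(((d : ℝ) + α) / 2)) := by
        rw [← rpow_natCast, ← rpow_mul hy0.le]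
        congr 1
        push_cast
        ring
      have e4 : (2 : ℝ) ^ (((d : ℝ) + α) / 2) = (1 / 2) ^ (-(((d : ℝ) + α) / 2)) := by
        rw [rpow_neg (by norm_num), ← inv_rpow (by norm_num)]
        norm_num
      rw [e3, e4, rhoA, ← mul_rpow (by norm_num) (by positivity)]
      apply rpow_le_rpow_of_nonpos (by positivity) (by nlinarith)
      linarith
    rw [e, mul_assoc]
    gcongr

/-- The constant in the bounds. -/
def cBd (d : ℕ) (α R : ℝ) : ℝ :=
  2 * lipC d α + 2 * (d + α) * (2 * (1 + R ^ 2)) ^ (((d : ℝ) + α) / 2)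

lemma lipC_nonneg (d : ℕ) (α : ℝ) (hα : 0 < α) : 0 ≤ lipC d α := by
  unfold lipC
  positivity

lemma cBd_nonneg (d : ℕ) (α : ℝ) (hα : 0 < α) (R : ℝ) : 0 ≤ cBd d α R := by
  have := lipC_nonneg d α hα
  unfold cBd
  positivity

lemma diffD_bound1 (d : ℕ) (α : ℝ) (hα : 0 < α) (x z : EuclideanSpace ℝ (Fin d)) :
    ‖rhoD d α (x + z) - rhoD d α (x - z)‖ ≤ 2 * lipC d α * ‖z‖ := by
  have h := (rhoD_lip d α hα).2 (x - z) (x + z)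
  have e : x + z - (x - z) = (2 : ℝ) • z := by
    rw [two_smul]
    abel
  rw [e, norm_smul] at h
  norm_num at h
  linarith

lemma diffD_bound2 (d : ℕ) (α : ℝ) (hα : 0 < α) (x z : EuclideanSpace ℝ (Fin d)) {R : ℝ}
    (hx : ‖x‖ ≤ R) :
    ‖rhoD d α (x + z) - rhoD d α (x - z)‖ ≤
      2 * (d + α) * (2 * (1 + R ^ 2)) ^ (((d : ℝ) + α) / 2) * rhoA d α z := by
  have h1 := norm_sub_le (rhoD d α (x + z)) (rhoD d α (x - z))
  have h2 := norm_rhoD_le d α hα (x + z)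
  have h3 := norm_rhoD_le d α hα (x - z)
  have hda : 0 ≤ (d : ℝ) + α := by positivity
  have h4 := mul_le_mul_of_nonneg_left (rhoA_add_le d α hα x z hx) hda
  have h5 := mul_le_mul_of_nonneg_left (rhoA_sub_le d α hα x z hx) hda
  linarith

lemma diffD_bound (d : ℕ) (α : ℝ) (hα : 0 < α) (x z : EuclideanSpace ℝ (Fin d)) {R : ℝ}
    (hx : ‖x‖ ≤ R) :
    ‖rhoD d α (x + z) - rhoD d α (x - z)‖ ≤ cBd d α R * ‖z‖ ∧
    ‖rhoD d α (x + z) - rhoD d α (x - z)‖ ≤ cBd d α R * rhoA d α z := by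
  have h1 := diffD_bound1 d α hα x z
  have h2 := diffD_bound2 d α hα x z hx
  have hl := lipC_nonneg d α hα
  have hr := (rhoA_pos d α z).le
  have hn := norm_nonneg z
  have hP : 0 ≤ 2 * (d + α) * (2 * (1 + R ^ 2)) ^ (((d : ℝ) + α) / 2) := by positivity
  unfold cBd
  constructor
  · nlinarith [mul_nonneg hP hn]
  · nlinarith [mul_nonneg hl hr]

/-- The integrand of `fieldB`. -/
def intF (d : ℕ) (α : ℝ) (x y : EuclideanSpace ℝ (Fin d)) : EuclideanSpace ℝ (Fin d) :=
  ((rhoA d α (x + y) - rhoA d α (x - y)) * ‖y‖ ^ (-(d : ℝ) - α)) • y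

/-- The derivative of the integrand of `fieldB`. -/
def intF' (d : ℕ) (α : ℝ) (x y : EuclideanSpace ℝ (Fin d)) :
    EuclideanSpace ℝ (Fin d) →L[ℝ] EuclideanSpace ℝ (Fin d) :=
  (‖y‖ ^ (-(d : ℝ) - α) • (rhoD d α (x + y) - rhoD d α (x - y))).smulRight y

lemma hasFDerivAt_intF (d : ℕ) (α : ℝ) (x y : EuclideanSpace ℝ (Fin d)) :
    HasFDerivAt (fun x => intF d α x y) (intF' d α x y) x := by
  have h1 : HasFDerivAt (fun x => rhoA d α (x + y)) (rhoD d α (x + y)) x := by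
    have h := (hasFDerivAt_rhoA d α (x + y)).comp x ((hasFDerivAt_id x).add_const y)
    rwa [ContinuousLinearMap.comp_id] at h
  have h2 : HasFDerivAt (fun x => rhoA d α (x - y)) (rhoD d α (x - y)) x := by
    have h := (hasFDerivAt_rhoA d α (x - y)).comp x ((hasFDerivAt_id x).sub_const y)
    rwa [ContinuousLinearMap.comp_id] at h
  exact ((h1.fun_sub h2).mul_const (‖y‖ ^ (-(d : ℝ) - α))).smul_const y

lemma measurable_ker (d : ℕ) (α : ℝ) :
    Measurable (fun y : EuclideanSpace ℝ (Fin d) => ‖y‖ ^ (-(d : ℝ) - α)) :=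
  measurable_norm.pow_const _

lemma meas_intF (d : ℕ) (α : ℝ) (x : EuclideanSpace ℝ (Fin d)) :
    AEStronglyMeasurable (intF d α x) := by
  have hc := continuous_rhoA d α
  have h1 : Continuous fun y => rhoA d α (x + y) - rhoA d α (x - y) := by fun_prop
  exact (h1.aestronglyMeasurable.mul (measurable_ker d α).aestronglyMeasurable).smul
    continuous_id.aestronglyMeasurable

lemma meas_intF' (d : ℕ) (α : ℝ) (hα : 0 < α) (x : EuclideanSpace ℝ (Fin d)) :
    AEStronglyMeasurable (intF' d α x) := by
  have hc := continuous_rhoD d α hα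
  have h1 : Continuous fun y => (rhoD d α (x + y) - rhoD d α (x - y)).smulRight y := by
    have h2 : Continuous fun y => rhoD d α (x + y) - rhoD d α (x - y) := by fun_prop
    exact ((ContinuousLinearMap.smulRightL ℝ (EuclideanSpace ℝ (Fin d))
      (EuclideanSpace ℝ (Fin d))).continuous.comp h2).clm_apply continuous_id
  have e : intF' d α x = fun y => ‖y‖ ^ (-(d : ℝ) - α) •
      (rhoD d α (x + y) - rhoD d α (x - y)).smulRight y := by
    funext y
    ext v
    simp [intF', mul_assoc]
  rw [e]
  exact (measurable_ker d α).aestronglyMeasurable.smul h1.aestronglyMeasurable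

lemma intF'_bound (d : ℕ) (hd : 1 ≤ d) (α : ℝ) (hα : 0 < α) (x y : EuclideanSpace ℝ (Fin d))
    {R : ℝ} (hx : ‖x‖ ≤ R) : ‖intF' d α x y‖ ≤ cBd d α R * domH d α y := by
  obtain ⟨h1, h2⟩ := diffD_bound d α hα x y hx
  have h := domH_bound d hd α hα (norm_nonneg _) y h1 h2
  rw [intF', ContinuousLinearMap.norm_smulRight_apply, norm_smul,
    Real.norm_of_nonneg (rpow_nonneg (norm_nonneg y) _)]
  linarith

lemma integrable_intF' (d : ℕ) (hd : 1 ≤ d) (α : ℝ) (hα : α ∈ Set.Ioo (0 : ℝ) 2)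
    (x : EuclideanSpace ℝ (Fin d)) : Integrable (intF' d α x) :=
  ((domH_integrable d hd α hα).const_mul (cBd d α ‖x‖)).mono' (meas_intF' d α hα.1 x)
    (Filter.Eventually.of_forall fun y => intF'_bound d hd α hα.1 x y le_rfl)

lemma integrable_intF (d : ℕ) (hd : 1 ≤ d) (α : ℝ) (hα : α ∈ Set.Ioo (0 : ℝ) 2)
    (x : EuclideanSpace ℝ (Fin d)) : Integrable (intF d α x) := by
  refine ((domH_integrable d hd α hα).const_mul
    (2 * (d + α) + 2 * (2 * (1 + ‖x‖ ^ 2)) ^ (((d : ℝ) + α) / 2))).mono' (meas_intF d α x)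
    (Filter.Eventually.of_forall fun y => ?_)
  have hα0 := hα.1
  have hn := norm_nonneg y
  have hr := (rhoA_pos d α y).le
  have hP : 0 ≤ (2 * (1 + ‖x‖ ^ 2)) ^ (((d : ℝ) + α) / 2) := by positivity
  have hda : 0 ≤ (d : ℝ) + α := by positivity
  have h1 : ‖rhoA d α (x + y) - rhoA d α (x - y)‖ ≤
      (2 * (d + α) + 2 * (2 * (1 + ‖x‖ ^ 2)) ^ (((d : ℝ) + α) / 2)) * ‖y‖ := by
    have h := rhoA_lip d α hα0 (x - y) (x + y)
    have e : x + y - (x - y) = (2 : ℝ) • y := by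
      rw [two_smul]
      abel
    rw [e, norm_smul] at h
    norm_num at h ⊢
    nlinarith [mul_nonneg hP hn]
  have h2 : ‖rhoA d α (x + y) - rhoA d α (x - y)‖ ≤
      (2 * (d + α) + 2 * (2 * (1 + ‖x‖ ^ 2)) ^ (((d : ℝ) + α) / 2)) * rhoA d α y := by
    have h := norm_sub_le (rhoA d α (x + y)) (rhoA d α (x - y))
    rw [Real.norm_of_nonneg (rhoA_pos d α (x + y)).le,
      Real.norm_of_nonneg (rhoA_pos d α (x - y)).le] at h
    have h4 := rhoA_add_le d α hα0 x y le_rfl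
    have h5 := rhoA_sub_le d α hα0 x y le_rfl
    nlinarith [mul_nonneg hda hr]
  have h := domH_bound d hd α hα0 (norm_nonneg _) y h1 h2
  rw [intF, norm_smul, norm_mul, Real.norm_of_nonneg (rpow_nonneg (norm_nonneg y) _)]
  linarith

lemma hasFDerivAt_integral (d : ℕ) (hd : 1 ≤ d) (α : ℝ) (hα : α ∈ Set.Ioo (0 : ℝ) 2)
    (x : EuclideanSpace ℝ (Fin d)) :
    HasFDerivAt (fun x => ∫ y, intF d α x y) (∫ y, intF' d α x y) x := by
  refine hasFDerivAt_integral_of_dominated_of_fderiv_le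
    (bound := fun y => cBd d α (‖x‖ + 1) * domH d α y)
    (Metric.ball_mem_nhds x one_pos)
    (Filter.Eventually.of_forall fun x => meas_intF d α x) (integrable_intF d hd α hα x)
    (meas_intF' d α hα.1 x) (Filter.Eventually.of_forall fun y x' hx' => ?_)
    ((domH_integrable d hd α hα).const_mul _)
    (Filter.Eventually.of_forall fun y x' _ => hasFDerivAt_intF d α x' y)
  refine intF'_bound d hd α hα.1 x' y ?_
  have := norm_le_norm_add_norm_sub' x' x
  have h2 : ‖x' - x‖ < 1 := by rwa [Metric.mem_ball, dist_eq_norm] at hx'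
  linarith

lemma continuous_integral' (d : ℕ) (hd : 1 ≤ d) (α : ℝ) (hα : α ∈ Set.Ioo (0 : ℝ) 2) :
    Continuous (fun x => ∫ y, intF' d α x y) := by
  refine continuous_iff_continuousAt.2 fun x => ?_
  refine continuousAt_of_dominated (bound := fun y => cBd d α (‖x‖ + 1) * domH d α y)
    (Filter.Eventually.of_forall fun x => meas_intF' d α hα.1 x) ?_
    ((domH_integrable d hd α hα).const_mul _) (Filter.Eventually.of_forall fun y => ?_)
  · filter_upwards [Metric.ball_mem_nhds x one_pos] with x' hx'
    refine Filter.Eventually.of_forall fun y => intF'_bound d hd α hα.1 x' y ?_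
    have := norm_le_norm_add_norm_sub' x' x
    have h2 : ‖x' - x‖ < 1 := by rwa [Metric.mem_ball, dist_eq_norm] at hx'
    linarith
  · have hc := continuous_rhoD d α hα.1
    have h2 : Continuous fun x => ‖y‖ ^ (-(d : ℝ) - α) •
      (rhoD d α (x + y) - rhoD d α (x - y)) := by fun_prop
    exact (((ContinuousLinearMap.smulRightL ℝ (EuclideanSpace ℝ (Fin d))
      (EuclideanSpace ℝ (Fin d))).continuous.comp h2).clm_apply continuous_const).continuousAt

/-- The second difference. -/
def sdiff2 (d : ℕ) (α : ℝ) (x z : EuclideanSpace ℝ (Fin d)) : ℝ :=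
  rhoA d α (x + z) + rhoA d α (x - z) - 2 * rhoA d α x

lemma hasFDerivAt_sdiff2 (d : ℕ) (α : ℝ) (x z : EuclideanSpace ℝ (Fin d)) :
    HasFDerivAt (sdiff2 d α x) (rhoD d α (x + z) - rhoD d α (x - z)) z := by
  have h1 : HasFDerivAt (fun z => rhoA d α (x + z)) (rhoD d α (x + z)) z := by
    have h := (hasFDerivAt_rhoA d α (x + z)).comp z ((hasFDerivAt_id z).const_add x)
    rwa [ContinuousLinearMap.comp_id] at h
  have h2 : HasFDerivAt (fun z => rhoA d α (x - z)) (-rhoD d α (x - z)) z := by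
    have h3 : HasFDerivAt (fun z => x - z) (-ContinuousLinearMap.id ℝ _) z :=
      (hasFDerivAt_id z).const_sub x
    have h4 := (hasFDerivAt_rhoA d α (x - z)).comp z h3
    rwa [ContinuousLinearMap.comp_neg, ContinuousLinearMap.comp_id] at h4
  have h := (h1.fun_add h2).sub_const (2 * rhoA d α x)
  rw [← sub_eq_add_neg] at h
  exact h

lemma sdiff2_bound1 (d : ℕ) (α : ℝ) (hα : 0 < α) (x z : EuclideanSpace ℝ (Fin d)) :
    ‖sdiff2 d α x z‖ ≤ 2 * lipC d α * ‖z‖ ^ 2 := by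
  have hl := lipC_nonneg d α hα
  have h := Convex.norm_image_sub_le_of_norm_hasFDerivWithin_le (𝕜 := ℝ)
    (s := Metric.closedBall (0 : EuclideanSpace ℝ (Fin d)) ‖z‖) (f := sdiff2 d α x)
    (x := 0) (y := z) (C := 2 * lipC d α * ‖z‖)
    (fun w _ => (hasFDerivAt_sdiff2 d α x w).hasFDerivWithinAt)
    (fun w hw => (diffD_bound1 d α hα x w).trans (by
      have : ‖w‖ ≤ ‖z‖ := by simpa using hw
      gcongr))
    (convex_closedBall _ _) (by simp) (by simp)
  have e : sdiff2 d α x 0 = 0 := by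
    simp [sdiff2]
    ring
  rw [e, sub_zero, sub_zero] at h
  linarith

lemma sdiff2_bound2 (d : ℕ) (α : ℝ) (hα : 0 < α) (x z : EuclideanSpace ℝ (Fin d)) :
    ‖sdiff2 d α x z‖ ≤ 2 := by
  have h1 := rhoA_le_one d α hα (x + z)
  have h2 := rhoA_le_one d α hα (x - z)
  have h3 := rhoA_le_one d α hα x
  have h4 := rhoA_pos d α (x + z)
  have h5 := rhoA_pos d α (x - z)
  have h6 := rhoA_pos d α x
  rw [Real.norm_eq_abs, abs_le, sdiff2]
  constructor <;> linarith

lemma continuous_sdiff2 (d : ℕ) (α : ℝ) (x : EuclideanSpace ℝ (Fin d)) :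
    Continuous (sdiff2 d α x) :=
  continuous_iff_continuousAt.2 fun z => (hasFDerivAt_sdiff2 d α x z).continuousAt

lemma integrable_sdiff2 (d : ℕ) (hd : 1 ≤ d) (α : ℝ) (hα : α ∈ Set.Ioo (0 : ℝ) 2)
    (x : EuclideanSpace ℝ (Fin d)) :
    Integrable (fun z => sdiff2 d α x z * ‖z‖ ^ (-(d : ℝ) - α)) := by
  have hl := lipC_nonneg d α hα.1
  refine ((domH_integrable d hd α hα).const_mul
    ((2 * lipC d α + 2) * 2 ^ (((d : ℝ) + α) / 2))).mono'
    ((continuous_sdiff2 d α x).aestronglyMeasurable.mul (measurable_ker d α).aestronglyMeasurable)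
    (Filter.Eventually.of_forall fun z => ?_)
  rw [norm_mul, Real.norm_of_nonneg (rpow_nonneg (norm_nonneg z) _)]
  refine domH_bound2 d α hα.1 (norm_nonneg _) (by linarith) z ?_ ?_
  · have := sdiff2_bound1 d α hα.1 x z
    nlinarith [sq_nonneg ‖z‖]
  · have := sdiff2_bound2 d α hα.1 x z
    linarith

/-- Scaling of the singular integral. -/
lemma scaling (d : ℕ) (α : ℝ) (x : EuclideanSpace ℝ (Fin d)) {t : ℝ} (ht : 0 < t) :
    ∫ y, sdiff2 d α x (t • y) * ‖y‖ ^ (-(d : ℝ) - α)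
      = t ^ α * ∫ y, sdiff2 d α x y * ‖y‖ ^ (-(d : ℝ) - α) := by
  have h := Measure.integral_comp_smul (volume : Measure (EuclideanSpace ℝ (Fin d)))
    (fun y => sdiff2 d α x y * ‖y‖ ^ (-(d : ℝ) - α)) t
  have e : ∀ y : EuclideanSpace ℝ (Fin d), sdiff2 d α x (t • y) * ‖y‖ ^ (-(d : ℝ) - α)
      = t ^ ((d : ℝ) + α) * (sdiff2 d α x (t • y) * ‖t • y‖ ^ (-(d : ℝ) - α)) := by
    intro y
    rw [norm_smul, Real.norm_of_nonneg ht.le, mul_rpow ht.le (norm_nonneg y),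
      show -(d : ℝ) - α = -((d : ℝ) + α) by ring, rpow_neg ht.le]
    have : t ^ ((d : ℝ) + α) ≠ 0 := (rpow_pos_of_pos ht _).ne'
    field_simp
  simp_rw [e]
  rw [integral_const_mul, h, smul_eq_mul, ← mul_assoc, finrank_euclideanSpace, Fintype.card_fin,
    abs_of_pos (by positivity), rpow_add ht, rpow_natCast]
  have : t ^ d ≠ 0 := (pow_pos ht d).ne'
  field_simp

lemma ibp (d : ℕ) (hd : 1 ≤ d) (α : ℝ) (hα : α ∈ Set.Ioo (0 : ℝ) 2)
    (x : EuclideanSpace ℝ (Fin d)) :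
    ∫ y, (rhoD d α (x + y) - rhoD d α (x - y)) y * ‖y‖ ^ (-(d : ℝ) - α)
      = α * ∫ y, sdiff2 d α x y * ‖y‖ ^ (-(d : ℝ) - α) := by
  have hα0 := hα.1
  have hC := cBd_nonneg d α hα0 ‖x‖
  have hcD := continuous_rhoD d α hα0
  have hcs := continuous_sdiff2 d α x
  have h4 : (1 : ℝ) ≤ 4 ^ (((d : ℝ) + α) / 2) := one_le_rpow (by norm_num) (by positivity)
  obtain ⟨-, hder⟩ := hasDerivAt_integral_of_dominated_loc_of_deriv_le (𝕜 := ℝ)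
    (μ := (volume : Measure (EuclideanSpace ℝ (Fin d))))
    (F := fun t y => sdiff2 d α x (t • y) * ‖y‖ ^ (-(d : ℝ) - α))
    (F' := fun t y => (rhoD d α (x + t • y) - rhoD d α (x - t • y)) y * ‖y‖ ^ (-(d : ℝ) - α))
    (x₀ := 1) (s := Set.Ioo (1 / 2 : ℝ) 2)
    (bound := fun y => (cBd d α ‖x‖ * (2 + 4 ^ (((d : ℝ) + α) / 2))) * domH d α y)
    (Ioo_mem_nhds (by norm_num) (by norm_num))
    (Filter.Eventually.of_forall fun t => by
      have h1 : Continuous fun y => sdiff2 d α x (t • y) := by fun_prop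
      exact h1.aestronglyMeasurable.mul (measurable_ker d α).aestronglyMeasurable)
    (by simpa using integrable_sdiff2 d hd α hα x)
    (by
      have h1 : Continuous fun y =>
          (rhoD d α (x + (1 : ℝ) • y) - rhoD d α (x - (1 : ℝ) • y)) y := by
        have h2 : Continuous fun y =>
          (rhoD d α (x + (1 : ℝ) • y) - rhoD d α (x - (1 : ℝ) • y)) := by fun_prop
        exact h2.clm_apply continuous_id
      exact h1.aestronglyMeasurable.mul (measurable_ker d α).aestronglyMeasurable)
    (Filter.Eventually.of_forall fun y t ht => by
      obtain ⟨h1, h2⟩ := diffD_bound d α hα0 x (t • y) le_rfl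
      have ht0 : 0 < t := by linarith [ht.1]
      have hn := norm_nonneg y
      have hr := (rhoA_pos d α y).le
      have hq : rhoA d α (t • y) ≤ 4 ^ (((d : ℝ) + α) / 2) * rhoA d α y := by
        apply rhoA_le_mul d α hα0 _ _ (by norm_num)
        rw [norm_smul, Real.norm_of_nonneg ht0.le, mul_pow]
        have : 1 ≤ 4 * t ^ 2 := by nlinarith [ht.1]
        nlinarith [mul_le_mul_of_nonneg_right this (sq_nonneg ‖y‖)]
      have h1' : ‖rhoD d α (x + t • y) - rhoD d α (x - t • y)‖ ≤
          (cBd d α ‖x‖ * (2 + 4 ^ (((d : ℝ) + α) / 2))) * ‖y‖ := by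
        refine h1.trans ?_
        rw [norm_smul, Real.norm_of_nonneg ht0.le, mul_assoc]
        gcongr
        linarith [ht.2]
      have h2' : ‖rhoD d α (x + t • y) - rhoD d α (x - t • y)‖ ≤
          (cBd d α ‖x‖ * (2 + 4 ^ (((d : ℝ) + α) / 2))) * rhoA d α y := by
        refine h2.trans ?_
        rw [mul_assoc]
        gcongr
        nlinarith
      have h := domH_bound d hd α hα0 (norm_nonneg _) y h1' h2'
      refine le_trans ?_ h
      rw [norm_mul, Real.norm_of_nonneg (rpow_nonneg hn _)]
      have hop := ContinuousLinearMap.le_opNorm (rhoD d α (x + t • y) - rhoD d α (x - t • y)) y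
      have := mul_le_mul_of_nonneg_right hop (rpow_nonneg hn (-(d : ℝ) - α))
      linarith)
    ((domH_integrable d hd α hα).const_mul _)
    (Filter.Eventually.of_forall fun y t _ => by
      have h1 : HasDerivAt (fun t : ℝ => t • y) y t := by
        simpa using (hasDerivAt_id t).smul_const y
      exact ((hasFDerivAt_sdiff2 d α x (t • y)).comp_hasDerivAt t h1).mul_const _)
  have h2 : HasDerivAt (fun t : ℝ => t ^ α * ∫ y, sdiff2 d α x y * ‖y‖ ^ (-(d : ℝ) - α))
      (α * ∫ y, sdiff2 d α x y * ‖y‖ ^ (-(d : ℝ) - α)) 1 := by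
    have := (hasDerivAt_rpow_const (x := 1) (p := α) (Or.inl one_ne_zero)).mul_const
      (∫ y, sdiff2 d α x y * ‖y‖ ^ (-(d : ℝ) - α))
    simpa using this
  have h3 := h2.congr_of_eventuallyEq (f₁ := fun t : ℝ =>
      ∫ y, sdiff2 d α x (t • y) * ‖y‖ ^ (-(d : ℝ) - α)) (by
    filter_upwards [lt_mem_nhds (zero_lt_one (α := ℝ))] with t ht
    exact scaling d α x ht)
  have := hder.unique h3
  simpa only [one_smul] using this

/-- The trace as a continuous linear map. -/
def trL (d : ℕ) : (EuclideanSpace ℝ (Fin d) →L[ℝ] EuclideanSpace ℝ (Fin d)) →L[ℝ] ℝ :=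
  ∑ i : Fin d, (EuclideanSpace.proj (𝕜 := ℝ) i).comp
    (ContinuousLinearMap.apply ℝ (EuclideanSpace ℝ (Fin d)) (EuclideanSpace.single i (1 : ℝ)))

lemma trL_apply (d : ℕ) (T : EuclideanSpace ℝ (Fin d) →L[ℝ] EuclideanSpace ℝ (Fin d)) :
    trL d T = ∑ i : Fin d, T (EuclideanSpace.single i 1) i := by
  simp [trL]

lemma trL_smulRight (d : ℕ) (f : EuclideanSpace ℝ (Fin d) →L[ℝ] ℝ) (y : EuclideanSpace ℝ (Fin d)) :
    trL d (f.smulRight y) = f y := by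
  have h := (EuclideanSpace.basisFun (Fin d) ℝ).sum_repr y
  rw [trL_apply]
  conv_rhs => rw [← h]
  rw [map_sum]
  refine Finset.sum_congr rfl fun i _ => ?_
  simp [mul_comm]

/-- **Lemma 4.1(iii).** `B` is continuously differentiable and its
divergence satisfies `div B(x) = Δ^{α/2} ρ_α(x)` for all `x`, where
`Δ^{α/2} f(x) = (α 2^α Γ((d+α)/2)/(Γ(d/2)Γ((2-α)/2))) ∫ (f(x+z)+f(x-z)-2f(x)) |z|^{-d-α} dz`. -/
theorem stmt_14 (d : ℕ) (hd : 1 ≤ d) (α : ℝ) (hα : α ∈ Set.Ioo (0 : ℝ) 2) :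
    ContDiff ℝ 1 (fieldB d α) ∧
    ∀ x : EuclideanSpace ℝ (Fin d),
      (∑ i : Fin d, fderiv ℝ (fieldB d α) x (EuclideanSpace.single i 1) i)
        = (α * 2 ^ α * Real.Gamma (((d : ℝ) + α) / 2)
            / (Real.Gamma ((d : ℝ) / 2) * Real.Gamma ((2 - α) / 2)))
          * ∫ z : EuclideanSpace ℝ (Fin d),
              (rhoA d α (x + z) + rhoA d α (x - z) - 2 * rhoA d α x)
                * ‖z‖ ^ (-(d : ℝ) - α) := by
  have hB : ∀ x, HasFDerivAt (fieldB d α) (cdA d α • ∫ y, intF' d α x y) x := fun x =>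
    (hasFDerivAt_integral d hd α hα x).const_smul (cdA d α)
  have hfd : fderiv ℝ (fieldB d α) = fun x => cdA d α • ∫ y, intF' d α x y :=
    funext fun x => (hB x).fderiv
  refine ⟨contDiff_one_iff_fderiv.2 ⟨fun x => (hB x).differentiableAt, ?_⟩, fun x => ?_⟩
  · rw [hfd]
    exact (continuous_integral' d hd α hα).const_smul (cdA d α)
  · rw [← trL_apply, hfd]
    change trL d (cdA d α • ∫ y, intF' d α x y) = _
    rw [map_smul, ← ContinuousLinearMap.integral_comp_comm _ (integrable_intF' d hd α hα x)]
    have e : ∀ y, trL d (intF' d α x y) =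
        (rhoD d α (x + y) - rhoD d α (x - y)) y * ‖y‖ ^ (-(d : ℝ) - α) := by
      intro y
      rw [intF', trL_smulRight, smul_apply, smul_eq_mul, mul_comm]
    simp_rw [e]
    rw [ibp d hd α hα x, smul_eq_mul, cdA]
    simp only [sdiff2]
    ring
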